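/- arXiv:1906.04502 — 2 statements merged into one kernel-verified Lean document; each statement's English description precedes it below -/
import Mathlib

section
/- Let γ = 1/2 and R_SSM(α) = α(α(α(2α-5) + 4) - (α-1)³/2)/((α-1)α² + 1). For every α with 0 < α ≤ 1/2, R_SSM(α) > α if and only if α > 2 - √3. In particular, at γ = 1/2 semi-selfish mining becomes profitable exactly at the threshold 2 - √3 ≈ 0.26795. -/
/-- Relative revenue of a single SSM miner with hash power α at propagation γ = 1/2. -/
noncomputable def R_SSM (α : ℝ) : ℝ :=
  α * (α * (α * (2 * α - 5) + 4) - (α - 1) ^ 3 / 2) / ((α - 1) * α ^ 2 + 1)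

theorem ssm_threshold_gamma_half (α : ℝ) (hα0 : 0 < α) (hα : α ≤ 1 / 2) :
    R_SSM α > α ↔ α > 2 - Real.sqrt 3 := by
  have hden : 0 < (α - 1) * α ^ 2 + 1 := by nlinarith [pow_pos hα0 3]
  have hsq : Real.sqrt 3 ^ 2 = 3 := Real.sq_sqrt (by norm_num)
  have hfac : 0 < α * (1 - α) / 2 * (2 + Real.sqrt 3 - α) :=
    mul_pos (div_pos (mul_pos hα0 (by linarith)) two_pos)
      (by linarith [Real.sqrt_nonneg 3])
  have hdiff : α * (α * (α * (2 * α - 5) + 4) - (α - 1) ^ 3 / 2)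
      - α * ((α - 1) * α ^ 2 + 1)
      = α * (1 - α) / 2 * (2 + Real.sqrt 3 - α) * (α - (2 - Real.sqrt 3)) := by
    linear_combination -(α * (1 - α) / 2) * hsq
  rw [R_SSM, gt_iff_lt, lt_div_iff₀ hden, ← sub_pos, hdiff, mul_pos_iff_of_pos_left hfac, sub_pos]
end

section
/- Let γ = 1/2 and R_SM(α) = (α(1-α)²(4α + (1-2α)/2) - α³)/(1 - α(1 + (2-α)α)). For every α with 0 < α ≤ 1/2, R_SM(α) > α if and only if α > 1/4. In particular, at γ = 1/2 selfish mining becomes profitable exactly at the threshold 1/4. -/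
/-- Eyal–Sirer relative revenue of a single selfish miner with hash power α at
propagation γ = 1/2. -/
noncomputable def R_SM (α : ℝ) : ℝ :=
  (α * (1 - α) ^ 2 * (4 * α + (1 - 2 * α) / 2) - α ^ 3) /
    (1 - α * (1 + (2 - α) * α))

theorem sm_threshold_gamma_half (α : ℝ) (hα0 : 0 < α) (hα : α ≤ 1 / 2) :
    R_SM α > α ↔ α > 1 / 4 := by
  have hden : 0 < 1 - α * (1 + (2 - α) * α) := by
    nlinarith [pow_pos hα0 3, mul_nonneg hα0.le (sub_nonneg.2 hα)]
  have hfac : α * (1 - α) ^ 2 * (4 * α + (1 - 2 * α) / 2) - α ^ 3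
      - α * (1 - α * (1 + (2 - α) * α)) = 2 * α * (1 - α) ^ 2 * (α - 1 / 4) := by
    ring
  have hpos : 0 < 2 * α * (1 - α) ^ 2 :=
    mul_pos (by linarith) (pow_pos (by linarith) 2)
  rw [gt_iff_lt, gt_iff_lt, R_SM, lt_div_iff₀ hden, ← sub_pos, hfac,
    mul_pos_iff_of_pos_left hpos, sub_pos]
end
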